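/- The configuration x = (10)^∞ ∈ X, defined by x_i = 1 for even i and x_i = 0 for odd i, is not an equicontinuity point of the elementary cellular automaton F_104; hence F_104 is not equicontinuous. -/

import Mathlib

/-- Cantor metric on configurations `ℤ → Bool`. -/
noncomputable def dC (x y : ℤ → Bool) : ℝ :=
  ∑' i : ℤ, if x i = y i then 0 else (1 / 2 : ℝ) ^ i.natAbs

/-- Local rule of the ECA with rule number `N`:
`(a,b,c)` is mapped to the coefficient of `2^(4a+2b+c)` in the binary expansion of `N`. -/
def localRule (N : ℕ) (a b c : Bool) : Bool :=
  N.testBit (4 * a.toNat + 2 * b.toNat + c.toNat)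

/-- The elementary cellular automaton with rule number `N`. -/
def eca (N : ℕ) (x : ℤ → Bool) : ℤ → Bool :=
  fun i => localRule N (x (i - 1)) (x i) (x (i + 1))

/-- `x` belongs to the cylinder `[u]_0`. -/
def inCyl (u : List Bool) (x : ℤ → Bool) : Prop :=
  ∀ j : Fin u.length, x ((j : ℕ) : ℤ) = u.get j

/-- `u` is an `m`-blocking word for `F`. -/
def Blocking (F : (ℤ → Bool) → ℤ → Bool) (m : ℕ) (u : List Bool) : Prop :=
  m ≤ u.length ∧ ∃ q : ℕ, q + m ≤ u.length ∧
    ∀ x y : ℤ → Bool, inCyl u x → inCyl u y → ∀ n : ℕ, ∀ j : ℤ,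
      (q : ℤ) ≤ j → j < (q : ℤ) + (m : ℤ) → F^[n] x j = F^[n] y j

/-- `x` is an equicontinuity point of `F`. -/
def EquicontinuityPoint (F : (ℤ → Bool) → ℤ → Bool) (x : ℤ → Bool) : Prop :=
  ∀ ε : ℝ, 0 < ε → ∃ δ : ℝ, 0 < δ ∧ ∀ y : ℤ → Bool, dC x y < δ →
    ∀ n : ℕ, dC (F^[n] x) (F^[n] y) < ε

/-- `F` is almost equicontinuous: it has at least one equicontinuity point. -/
def AlmostEquicontinuousCA (F : (ℤ → Bool) → ℤ → Bool) : Prop :=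
  ∃ x : ℤ → Bool, EquicontinuityPoint F x

/-- `F` is equicontinuous: every point is an equicontinuity point. -/
def EquicontinuousCA (F : (ℤ → Bool) → ℤ → Bool) : Prop :=
  ∀ x : ℤ → Bool, EquicontinuityPoint F x

/-- `F` is sensitive to initial conditions. -/
def SensitiveCA (F : (ℤ → Bool) → ℤ → Bool) : Prop :=
  ∃ ε : ℝ, 0 < ε ∧ ∀ x : ℤ → Bool, ∀ δ : ℝ, 0 < δ →
    ∃ y : ℤ → Bool, dC x y < δ ∧ ∃ n : ℕ, ε ≤ dC (F^[n] x) (F^[n] y)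

/-- `F` is positively expansive. -/
def PosExpansiveCA (F : (ℤ → Bool) → ℤ → Bool) : Prop :=
  ∃ ε : ℝ, 0 < ε ∧ ∀ x y : ℤ → Bool, x ≠ y →
    ∃ n : ℕ, ε ≤ dC (F^[n] x) (F^[n] y)

/-- The power `σ^q` of the shift map, for `q : ℤ` : `(σ^q x)_i = x_{i+q}`. -/
def shiftBy (q : ℤ) (x : ℤ → Bool) : ℤ → Bool := fun i => x (i + q)

/-- `F` is left-permutive. -/
def LeftPermutive (N : ℕ) : Prop :=
  ∀ b c : Bool, Function.Bijective (fun a => localRule N a b c)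

/-- `F` is right-permutive. -/
def RightPermutive (N : ℕ) : Prop :=
  ∀ a b : Bool, Function.Bijective (fun c => localRule N a b c)

/-- `U` is open in the Cantor metric topology. -/
def IsOpenC (U : Set (ℤ → Bool)) : Prop :=
  ∀ x ∈ U, ∃ δ : ℝ, 0 < δ ∧ ∀ y : ℤ → Bool, dC x y < δ → y ∈ U

/-- `F` is topologically transitive. -/
def TransitiveCA (F : (ℤ → Bool) → ℤ → Bool) : Prop :=
  ∀ U V : Set (ℤ → Bool), IsOpenC U → IsOpenC V → U.Nonempty → V.Nonempty →
    ∃ n : ℕ, 0 < n ∧ ((F^[n]) '' U ∩ V).Nonempty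

lemma summable_half_natAbs : Summable (fun i : ℤ => (1 / 2 : ℝ) ^ i.natAbs) := by
  apply Summable.of_nat_of_neg
  · simpa using summable_geometric_two
  · simpa using summable_geometric_two

/-- The alternating configuration truncated to cells `≤ K`. -/
def truncAlt (K : ℤ) : ℤ → Bool := fun i => decide (i % 2 = 0 ∧ i ≤ K)

lemma localRule_104 (a b c : Bool) :
    localRule 104 a b c = ((a && b && !c) || (a && !b && c) || (!a && b && c)) := by
  cases a <;> cases b <;> cases c <;> rfl

lemma iter_alt (n : ℕ) : (eca 104)^[n] (fun i : ℤ => decide (i % 2 = 0)) =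
    fun i : ℤ => decide ((i + n) % 2 = 0) := by
  induction n with
  | zero => simp
  | succ n ih =>
    rw [Function.iterate_succ_apply', ih]
    funext i
    simp only [eca, localRule_104]
    push_cast
    rcases Int.emod_two_eq_zero_or_one (i + n) with h | h
    · have h1 : ¬ (i - 1 + n) % 2 = 0 := by omega
      have h2 : ¬ (i + 1 + n) % 2 = 0 := by omega
      have h3 : ¬ (i + (n + 1)) % 2 = 0 := by omega
      simp [h, h1, h2, h3]
    · have h1 : (i - 1 + n) % 2 = 0 := by omega
      have h2 : (i + 1 + n) % 2 = 0 := by omega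
      have h3 : (i + (n + 1)) % 2 = 0 := by omega
      simp [h, h1, h2, h3]

lemma iter_trunc (K : ℤ) (n : ℕ) : (eca 104)^[n] (truncAlt K) =
    fun i : ℤ => decide ((i + n) % 2 = 0 ∧ i ≤ K - n) := by
  induction n with
  | zero => funext i; simp [truncAlt]
  | succ n ih =>
    rw [Function.iterate_succ_apply', ih]
    funext i
    simp only [eca, localRule_104]
    push_cast
    rcases Int.emod_two_eq_zero_or_one (i + n) with h | h
    · have h1 : ¬ (i - 1 + n) % 2 = 0 := by omega
      have h2 : ¬ (i + 1 + n) % 2 = 0 := by omega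
      have h3 : ¬ (i + (n + 1)) % 2 = 0 := by omega
      simp [h1, h2, h3]
    · have h1 : (i - 1 + n) % 2 = 0 := by omega
      have h2 : (i + 1 + n) % 2 = 0 := by omega
      have h3 : (i + (n + 1)) % 2 = 0 := by omega
      by_cases hK : i + 1 ≤ K - n
      · have h4 : i - 1 ≤ K - n := by omega
        have h5 : i ≤ K - (n + 1) := by omega
        simp [h, h1, h2, h3, hK, h4, h5]
      · have h5 : ¬ i ≤ K - (n + 1) := by omega
        simp [h, h1, h2, h3, hK, h5]

lemma tendsto_trunc : Filter.Tendsto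
    (fun k : ℕ => dC (fun i : ℤ => decide (i % 2 = 0)) (truncAlt k))
    Filter.atTop (nhds 0) := by
  have h := tendsto_tsum_of_dominated_convergence (𝓕 := Filter.atTop)
    (f := fun (k : ℕ) (i : ℤ) =>
      if decide (i % 2 = 0) = truncAlt k i then (0 : ℝ) else (1 / 2 : ℝ) ^ i.natAbs)
    (g := fun _ => 0) summable_half_natAbs ?_ ?_
  · simpa [dC] using h
  · intro i
    apply tendsto_const_nhds.congr'
    filter_upwards [Filter.eventually_ge_atTop i.natAbs] with k hk
    have : i ≤ (k : ℤ) := by omega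
    simp [truncAlt, this]
  · refine Filter.Eventually.of_forall fun k i => ?_
    split_ifs
    · simp
    · simp

lemma one_le_dC (x y : ℤ → Bool) (h : x 0 ≠ y 0) : 1 ≤ dC x y := by
  have hs : Summable (fun i : ℤ => if x i = y i then (0 : ℝ) else (1 / 2 : ℝ) ^ i.natAbs) := by
    refine Summable.of_nonneg_of_le (fun i => ?_) (fun i => ?_) summable_half_natAbs
    · split_ifs <;> positivity
    · split_ifs
      · positivity
      · exact le_rfl
  have := hs.le_tsum 0 (fun i _ => by split_ifs <;> positivity)
  simpa [dC, h] using this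

lemma alt_not_equicontinuityPoint :
    ¬ EquicontinuityPoint (eca 104) (fun i : ℤ => decide (i % 2 = 0)) := by
  intro h
  obtain ⟨δ, hδ, H⟩ := h 1 one_pos
  obtain ⟨k, hk⟩ := (tendsto_trunc.eventually (gt_mem_nhds hδ)).exists
  have h1 := H _ hk (2 * k + 2)
  refine absurd h1 (not_lt.mpr (one_le_dC _ _ ?_))
  rw [iter_alt, iter_trunc]
  have h2 : ((0 : ℤ) + ((2 * k + 2 : ℕ) : ℤ)) % 2 = 0 := by omega
  have h3 : ¬ (0 : ℤ) ≤ (k : ℤ) - ((2 * k + 2 : ℕ) : ℤ) := by omega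
  simp only [h2, h3]
  simp

/-- The configuration `(10)^∞` (state 1 at even cells, state 0 at odd cells) is not an
equicontinuity point of ECA rule 104; hence `F_104` is not equicontinuous. -/
theorem eca104_not_equicontinuous :
    ¬ EquicontinuityPoint (eca 104) (fun i : ℤ => decide (i % 2 = 0)) ∧
      ¬ EquicontinuousCA (eca 104) := by
  exact ⟨alt_not_equicontinuityPoint, fun h => alt_not_equicontinuityPoint (h _)⟩
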